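/- Let f : ℤ → ℕ₀ ∪ {∞} be any function such that f⁻¹(0) is finite. Then there exists a set B ⊆ ℤ such that r_B(x) = f(x) for all x ∈ ℤ; in particular, B is an asymptotic basis of order 2 for ℤ. -/

import Mathlib

/-- The (unrestricted) representation function of a subset `B` of an additive
semigroup: `rep B x` counts the number of sets `{b, b'} ⊆ B` (with `b = b'`
allowed) such that `b + b' = x`. -/
noncomputable def rep {X : Type*} [Add X] (B : Set X) (x : X) : ℕ∞ :=
  {s : Set X | ∃ b ∈ B, ∃ b' ∈ B, b + b' = x ∧ s = {b, b'}}.encard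

theorem rep_mono {X : Type*} [Add X] {B C : Set X} (h : B ⊆ C) (x : X) : rep B x ≤ rep C x :=
  Set.encard_le_encard fun _ ⟨b, hb, b', hb', hx, hs⟩ => ⟨b, h hb, b', h hb', hx, hs⟩

theorem rep_iUnion_le_of_directed {X ι : Type*} [Add X] [Nonempty ι] {B : ι → Set X}
    (hB : Directed (· ⊆ ·) B) {x : X} {m : ℕ∞} (h : ∀ i, rep (B i) x ≤ m) :
    rep (⋃ i, B i) x ≤ m := by
  by_contra! hlt
  obtain ⟨t, ht, htm⟩ := Set.exists_subset_encard_eq (Order.add_one_le_of_lt hlt)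
  have hm : m ≠ ⊤ := hlt.ne_top
  have hfin : t.Finite := Set.encard_ne_top_iff.1 (by
    rw [htm]; exact WithTop.add_ne_top.2 ⟨hm, WithTop.one_ne_top⟩)
  have hdir : Directed (· ⊆ ·) fun i =>
      {s : Set X | ∃ b ∈ B i, ∃ b' ∈ B i, b + b' = x ∧ s = {b, b'}} :=
    hB.mono_comp (· ⊆ ·) (g := fun C : Set X =>
      {s : Set X | ∃ b ∈ C, ∃ b' ∈ C, b + b' = x ∧ s = {b, b'}})
      fun _ _ hCD _ ⟨b, hb, b', hb', hx, hs⟩ => ⟨b, hCD hb, b', hCD hb', hx, hs⟩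
  have hsub : t ⊆ ⋃ i, {s : Set X | ∃ b ∈ B i, ∃ b' ∈ B i, b + b' = x ∧ s = {b, b'}} := by
    intro s hs
    obtain ⟨b, hb, b', hb', hx, rfl⟩ := ht hs
    obtain ⟨i, hi⟩ := Set.mem_iUnion.1 hb
    obtain ⟨j, hj⟩ := Set.mem_iUnion.1 hb'
    obtain ⟨k, hik, hjk⟩ := hB i j
    exact Set.mem_iUnion.2 ⟨k, b, hik hi, b', hjk hj, hx, rfl⟩
  obtain ⟨i, hi⟩ := hdir.exists_mem_subset_of_finset_subset_biUnion (s := hfin.toFinset)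
    (by simpa using hsub)
  have hle : m + 1 ≤ m := htm ▸ (Set.encard_le_encard (by simpa using hi)).trans (h i)
  exact (ENat.add_one_le_iff hm).1 hle |>.false

theorem exists_bound (s : Set ℤ) (hs : s.Finite) : ∃ M : ℤ, ∀ b ∈ s, -M ≤ b ∧ b ≤ M := by
  obtain ⟨u, hu⟩ := hs.bddAbove
  obtain ⟨l, hl⟩ := hs.bddBelow
  refine ⟨max u (-l), fun b hb => ?_⟩
  have := hu hb
  have := hl hb
  omega

theorem exists_superset_rep_add_one_le {f : ℤ → ℕ∞} (hf : (f ⁻¹' {0}).Finite) (B : Finset ℤ)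
    (hB : ∀ y, rep (B : Set ℤ) y ≤ f y) {x : ℤ} (hx : rep (B : Set ℤ) x < f x) :
    ∃ C : Finset ℤ, B ⊆ C ∧ (∀ y, rep (C : Set ℤ) y ≤ f y) ∧
      rep (B : Set ℤ) x + 1 ≤ rep (C : Set ℤ) x := by
  obtain ⟨M, hM⟩ := exists_bound (↑B ∪ f ⁻¹' {0} ∪ {x})
    ((B.finite_toSet.union hf).union (Set.finite_singleton x))
  have hMB : ∀ b ∈ B, -M ≤ b ∧ b ≤ M := fun b hb => hM b (by simp [hb])
  have hM0 : ∀ y, f y = 0 → -M ≤ y ∧ y ≤ M := fun y hy => hM y (by simp [hy])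
  have hMx : -M ≤ x ∧ x ≤ M := hM x (by simp)
  set K : ℤ := 10 * M + 10
  have hmem : ∀ c, c ∈ insert (-K) (insert (x + K) B) →
      c = -K ∨ c = x + K ∨ (c ∈ B ∧ -M ≤ c ∧ c ≤ M) := by
    intro c hc
    rcases Finset.mem_insert.1 hc with h | hc
    · exact .inl h
    rcases Finset.mem_insert.1 hc with h | hc
    · exact .inr (.inl h)
    · exact .inr (.inr ⟨hc, hMB c hc⟩)
  have hsub : B ⊆ insert (-K) (insert (x + K) B) :=
    (Finset.subset_insert _ _).trans (Finset.subset_insert _ _)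
  refine ⟨insert (-K) (insert (x + K) B), hsub, fun y => ?_, ?_⟩
  · by_cases hyx : y = x
    · subst hyx
      refine le_trans ?_ (Order.add_one_le_of_lt hx)
      refine le_trans (Set.encard_le_encard ?_) (Set.encard_insert_le _ ({-K, y + K} : Set ℤ))
      rintro s ⟨b, hb, b', hb', hy, rfl⟩
      rcases hmem b hb with h | h | ⟨h, h1⟩ <;> rcases hmem b' hb' with h' | h' | ⟨h', h1'⟩ <;>
        first
        | omega
        | exact .inr ⟨b, h, b', h', hy, rfl⟩
        | (subst h h'; exact .inl rfl)
        | (subst h h'; exact .inl (Set.pair_comm _ _))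
    by_cases hy : -(2 * M) ≤ y ∧ y ≤ 2 * M
    · refine le_trans (Set.encard_le_encard ?_) (hB y)
      rintro s ⟨b, hb, b', hb', hs, rfl⟩
      rcases hmem b hb with h | h | ⟨h, h1⟩ <;> rcases hmem b' hb' with h' | h' | ⟨h', h1'⟩ <;>
        first
        | omega
        | exact ⟨b, h, b', h', hs, rfl⟩
    · refine le_trans ?_ (Order.one_le_iff_pos.2 (pos_iff_ne_zero.2 fun h0 => ?_) : 1 ≤ f y)
      · refine Set.encard_le_one_iff.2 ?_
        rintro s t ⟨a, ha, a', ha', hs, rfl⟩ ⟨c, hc, c', hc', ht, rfl⟩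
        have key : (a = c ∧ a' = c') ∨ (a = c' ∧ a' = c) := by
          rcases hmem a ha with h | h | ⟨-, h⟩ <;> rcases hmem a' ha' with h' | h' | ⟨-, h'⟩ <;>
          rcases hmem c hc with g | g | ⟨-, g⟩ <;> rcases hmem c' hc' with g' | g' | ⟨-, g'⟩ <;>
          omega
        rcases key with ⟨rfl, rfl⟩ | ⟨rfl, rfl⟩
        · rfl
        · exact Set.pair_comm _ _
      · have := hM0 y h0
        omega
  · have hnot : ({-K, x + K} : Set ℤ) ∉
        {s : Set ℤ | ∃ b ∈ (B : Set ℤ), ∃ b' ∈ (B : Set ℤ), b + b' = x ∧ s = {b, b'}} := by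
      rintro ⟨b, hb, b', hb', -, hs⟩
      have hK : -K ∈ ({b, b'} : Set ℤ) := hs ▸ Set.mem_insert _ _
      have h := hMB b hb
      have h' := hMB b' hb'
      rcases hK with hK | hK
      · omega
      · have : -K = b' := hK
        omega
    rw [rep, ← Set.encard_insert_of_notMem hnot]
    refine Set.encard_le_encard (Set.insert_subset ?_ ?_)
    · exact ⟨-K, by simp, x + K, by simp, by ring, rfl⟩
    · rintro s ⟨b, hb, b', hb', hs⟩
      exact ⟨b, hsub hb, b', hsub hb', hs⟩

theorem exists_superset_le_rep {f : ℤ → ℕ∞} (hf : (f ⁻¹' {0}).Finite) (B : Finset ℤ)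
    (hB : ∀ y, rep (B : Set ℤ) y ≤ f y) (x : ℤ) (k : ℕ) (hk : k ≤ f x) :
    ∃ C : Finset ℤ, B ⊆ C ∧ (∀ y, rep (C : Set ℤ) y ≤ f y) ∧ k ≤ rep (C : Set ℤ) x := by
  induction k with
  | zero => exact ⟨B, subset_rfl, hB, by simp⟩
  | succ k ih =>
    have hlt : (k : ℕ∞) < f x := lt_of_lt_of_le (by exact_mod_cast k.lt_succ_self) hk
    obtain ⟨C, hBC, hC, hkC⟩ := ih hlt.le
    by_cases hCx : rep (C : Set ℤ) x < f x
    · obtain ⟨D, hCD, hD, hxD⟩ := exists_superset_rep_add_one_le hf C hC hCx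
      refine ⟨D, hBC.trans hCD, hD, le_trans ?_ hxD⟩
      push_cast
      gcongr
    · exact ⟨C, hBC, hC, hk.trans (not_lt.1 hCx)⟩

theorem stmt10 (f : ℤ → ℕ∞) (hf : (f ⁻¹' {0}).Finite) :
    ∃ B : Set ℤ, (∀ x : ℤ, rep B x = f x) ∧
      {x : ℤ | ¬ 1 ≤ rep B x}.Finite := by
  suffices h : ∃ B : Set ℤ, ∀ x : ℤ, rep B x = f x by
    obtain ⟨B, hB⟩ := h
    refine ⟨B, hB, hf.subset fun x hx => ?_⟩
    simpa [hB, Order.one_le_iff_ne_zero] using hx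
  let P := {B : Finset ℤ // ∀ y, rep (B : Set ℤ) y ≤ f y}
  let p : P := ⟨∅, fun y => by simp [rep]⟩
  let D : ℤ × ℕ → Order.Cofinal P := fun i =>
    { carrier := {B | i.2 ≤ f i.1 → i.2 ≤ rep (B.1 : Set ℤ) i.1}
      isCofinal := fun B => by
        by_cases hi : i.2 ≤ f i.1
        · obtain ⟨C, hBC, hC, hi'⟩ := exists_superset_le_rep hf B.1 B.2 i.1 i.2 hi
          exact ⟨⟨C, hC⟩, fun _ => hi', hBC⟩
        · exact ⟨B, fun h => absurd h hi, le_rfl⟩ }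
  let I := Order.idealOfCofinals p D
  have : Nonempty I := ⟨⟨p, Order.mem_idealOfCofinals p D⟩⟩
  have hdir : Directed (· ⊆ ·) fun B : I => (B.1.1 : Set ℤ) := fun B C => by
    obtain ⟨E, hE, hBE, hCE⟩ := I.directed B.1 B.2 C.1 C.2
    exact ⟨⟨E, hE⟩, Finset.coe_subset.2 hBE, Finset.coe_subset.2 hCE⟩
  refine ⟨⋃ B : I, (B.1.1 : Set ℤ), fun x =>
    le_antisymm (rep_iUnion_le_of_directed hdir fun B => B.1.2 x) ?_⟩
  refine ENat.forall_natCast_le_iff_le.1 fun k hk => ?_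
  obtain ⟨B, hBD, hBI⟩ := Order.cofinal_meets_idealOfCofinals p D (x, k)
  exact (hBD hk).trans
    (rep_mono (Set.subset_iUnion (fun B : I => (B.1.1 : Set ℤ)) ⟨B, hBI⟩) x)
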